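/- arXiv:1506.02583 — 2 statements merged into one kernel-verified Lean document; each statement's English description precedes it below -/
import Mathlib

section
/- Let m be a positive natural number, F : ℝ^m → ℝ^m, U⁻ ∈ ℝ^m, h > 0 a real number, and V₁, V₂ ∈ ℝ^m. Suppose F is differentiable on an open convex set containing the segments from U⁻ to U⁻ + h·V₁ and from U⁻ to U⁻ + h·V₂, its derivative F′ is Lipschitz continuous on that set with constant M ≥ 0, and the Jacobian A = F′(U⁻) is symmetric, i.e. ⟪A·V₁, V₂⟫ = ⟪V₁, A·V₂⟫ for all V₁, V₂. Define a(V) = (F(U⁻ + h·V) − F(U⁻))/h. Then |⟪V₂, a(V₁)⟫ − ⟪a(V₂), V₁⟫| ≤ (M·h/2)·(‖V₁‖²·‖V₂‖ + ‖V₂‖²·‖V₁‖). In particular, the deviation of the operator a from symmetry is O(h). -/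
open RealInnerProductSpace

/-- First-order Taylor estimate: if the derivative of `F` is `M`-Lipschitz on a set containing the
segment from `x` to `x + v`, the linearization error at `x + v` is at most `M / 2 * ‖v‖ ^ 2`. -/
theorem norm_add_sub_sub_fderiv_le_of_lipschitz
    {E G : Type*} [NormedAddCommGroup E] [NormedSpace ℝ E] [NormedAddCommGroup G] [NormedSpace ℝ G]
    {F : E → G} {F' : E → E →L[ℝ] G} {s : Set E} {M : ℝ} {x v : E}
    (hseg : segment ℝ x (x + v) ⊆ s) (hdiff : ∀ y ∈ s, HasFDerivAt F (F' y) y)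
    (hLip : ∀ y ∈ s, ∀ z ∈ s, ‖F' y - F' z‖ ≤ M * ‖y - z‖) :
    ‖F (x + v) - F x - F' x v‖ ≤ M / 2 * ‖v‖ ^ 2 := by
  have hmem : ∀ t ∈ Set.Icc (0 : ℝ) 1, x + t • v ∈ s := fun t ht ↦ hseg <| by
    rw [segment_eq_image']
    exact ⟨t, ht, by simp⟩
  have hderiv : ∀ t ∈ Set.Icc (0 : ℝ) 1,
      HasDerivAt (fun t : ℝ ↦ F (x + t • v) - F x - t • F' x v) (F' (x + t • v) v - F' x v) t := by
    intro t ht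
    have hline : HasDerivAt (fun t : ℝ ↦ x + t • v) v t := by
      simpa using ((hasDerivAt_id t).smul_const v).const_add x
    have hlin : HasDerivAt (fun t : ℝ ↦ t • F' x v) (F' x v) t := by
      simpa using (hasDerivAt_id t).smul_const (F' x v)
    exact (((hdiff _ (hmem t ht)).comp_hasDerivAt t hline).sub_const (F x)).sub hlin
  have hbound : ∀ t ∈ Set.Ico (0 : ℝ) 1,
      ‖F' (x + t • v) v - F' x v‖ ≤ M * ‖v‖ ^ 2 * t := by
    intro t ht
    have hx : x ∈ s := by simpa using hmem 0 (by simp)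
    calc ‖F' (x + t • v) v - F' x v‖ = ‖(F' (x + t • v) - F' x) v‖ := by simp
      _ ≤ ‖F' (x + t • v) - F' x‖ * ‖v‖ := ContinuousLinearMap.le_opNorm _ _
      _ ≤ M * ‖x + t • v - x‖ * ‖v‖ := by
        gcongr
        exact hLip _ (hmem t ⟨ht.1, ht.2.le⟩) _ hx
      _ = M * ‖v‖ ^ 2 * t := by
        rw [add_sub_cancel_left, norm_smul, Real.norm_of_nonneg ht.1]
        ring
  have hquad : ∀ t : ℝ, HasDerivAt (fun t ↦ M / 2 * ‖v‖ ^ 2 * t ^ 2) (M * ‖v‖ ^ 2 * t) t := by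
    intro t
    have hpow := (hasDerivAt_pow 2 t).const_mul (M / 2 * ‖v‖ ^ 2)
    refine hpow.congr_deriv ?_
    push_cast
    ring
  simpa using image_norm_le_of_norm_deriv_right_le_deriv_boundary
    (fun t ht ↦ (hderiv t ht).continuousAt.continuousWithinAt)
    (fun t ht ↦ (hderiv t ⟨ht.1, ht.2.le⟩).hasDerivWithinAt)
    (by simp) hquad hbound (Set.right_mem_Icc.2 zero_le_one)

/-- The forward difference quotient of step `h` in direction `v` differs from the derivative in
direction `v` by at most `M * h / 2 * ‖v‖ ^ 2` when the derivative is `M`-Lipschitz. -/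
theorem norm_forward_difference_sub_fderiv_le
    {E G : Type*} [NormedAddCommGroup E] [NormedSpace ℝ E] [NormedAddCommGroup G] [NormedSpace ℝ G]
    {F : E → G} {F' : E → E →L[ℝ] G} {s : Set E} {M h : ℝ} {x v : E} (hh : 0 < h)
    (hseg : segment ℝ x (x + h • v) ⊆ s) (hdiff : ∀ y ∈ s, HasFDerivAt F (F' y) y)
    (hLip : ∀ y ∈ s, ∀ z ∈ s, ‖F' y - F' z‖ ≤ M * ‖y - z‖) :
    ‖h⁻¹ • (F (x + h • v) - F x) - F' x v‖ ≤ M * h / 2 * ‖v‖ ^ 2 := by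
  have heq : h⁻¹ • (F (x + h • v) - F x) - F' x v =
      h⁻¹ • (F (x + h • v) - F x - F' x (h • v)) := by
    rw [smul_sub _ (_ - _), map_smul, inv_smul_smul₀ hh.ne']
  rw [heq, norm_smul, Real.norm_of_nonneg (inv_nonneg.2 hh.le)]
  calc h⁻¹ * ‖F (x + h • v) - F x - F' x (h • v)‖ ≤ h⁻¹ * (M / 2 * ‖h • v‖ ^ 2) := by
        gcongr
        exact norm_add_sub_sub_fderiv_le_of_lipschitz hseg hdiff hLip
    _ = M * h / 2 * ‖v‖ ^ 2 := by
        rw [norm_smul, Real.norm_of_nonneg hh.le]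
        field_simp

/-- If `F` is differentiable on an open convex set containing the
segments from `U⁻` to `U⁻ + h·V₁` and from `U⁻` to `U⁻ + h·V₂`, its Jacobian is
Lipschitz there with constant `M ≥ 0`, and the Jacobian `A = F'(U⁻)` is symmetric,
then the forward-difference operator `a(V) = (F(U⁻ + h·V) − F(U⁻))/h` deviates
from symmetry by at most `(M·h/2)·(‖V₁‖²·‖V₂‖ + ‖V₂‖²·‖V₁‖)`, which is `O(h)`. -/
theorem forward_difference_symmetry_deviation
    (m : ℕ) (hm : 0 < m)
    (F : EuclideanSpace ℝ (Fin m) → EuclideanSpace ℝ (Fin m))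
    (F' : EuclideanSpace ℝ (Fin m) →
      (EuclideanSpace ℝ (Fin m) →L[ℝ] EuclideanSpace ℝ (Fin m)))
    (Uminus V₁ V₂ : EuclideanSpace ℝ (Fin m))
    (h : ℝ) (hh : 0 < h)
    (M : ℝ) (hM : 0 ≤ M)
    (s : Set (EuclideanSpace ℝ (Fin m)))
    (hs_open : IsOpen s) (hs_conv : Convex ℝ s)
    (hseg₁ : segment ℝ Uminus (Uminus + h • V₁) ⊆ s)
    (hseg₂ : segment ℝ Uminus (Uminus + h • V₂) ⊆ s)
    (hdiff : ∀ x ∈ s, HasFDerivAt F (F' x) x)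
    (hLip : ∀ x ∈ s, ∀ y ∈ s, ‖F' x - F' y‖ ≤ M * ‖x - y‖)
    (hsym : ∀ W₁ W₂ : EuclideanSpace ℝ (Fin m),
      ⟪(F' Uminus) W₁, W₂⟫ = ⟪W₁, (F' Uminus) W₂⟫)
    (a : EuclideanSpace ℝ (Fin m) → EuclideanSpace ℝ (Fin m))
    (ha : ∀ W, a W = h⁻¹ • (F (Uminus + h • W) - F Uminus)) :
    |⟪V₂, a V₁⟫ - ⟪a V₂, V₁⟫| ≤
      M * h / 2 * (‖V₁‖ ^ 2 * ‖V₂‖ + ‖V₂‖ ^ 2 * ‖V₁‖) := by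
  have h₁ : ‖a V₁ - F' Uminus V₁‖ ≤ M * h / 2 * ‖V₁‖ ^ 2 := by
    rw [ha]
    exact norm_forward_difference_sub_fderiv_le hh hseg₁ hdiff hLip
  have h₂ : ‖a V₂ - F' Uminus V₂‖ ≤ M * h / 2 * ‖V₂‖ ^ 2 := by
    rw [ha]
    exact norm_forward_difference_sub_fderiv_le hh hseg₂ hdiff hLip
  have heq : ⟪V₂, a V₁⟫ - ⟪a V₂, V₁⟫ =
      ⟪V₂, a V₁ - F' Uminus V₁⟫ - ⟪a V₂ - F' Uminus V₂, V₁⟫ := by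
    rw [inner_sub_right, inner_sub_left, hsym V₂ V₁]
    ring
  rw [heq]
  calc |⟪V₂, a V₁ - F' Uminus V₁⟫ - ⟪a V₂ - F' Uminus V₂, V₁⟫|
      ≤ |⟪V₂, a V₁ - F' Uminus V₁⟫| + |⟪a V₂ - F' Uminus V₂, V₁⟫| := abs_sub _ _
    _ ≤ ‖V₂‖ * ‖a V₁ - F' Uminus V₁‖ + ‖a V₂ - F' Uminus V₂‖ * ‖V₁‖ :=
        add_le_add (abs_real_inner_le_norm _ _) (abs_real_inner_le_norm _ _)
    _ ≤ ‖V₂‖ * (M * h / 2 * ‖V₁‖ ^ 2) + M * h / 2 * ‖V₂‖ ^ 2 * ‖V₁‖ := by gcongr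
    _ = M * h / 2 * (‖V₁‖ ^ 2 * ‖V₂‖ + ‖V₂‖ ^ 2 * ‖V₁‖) := by ring
end

section
/- Let m and k be positive natural numbers. Let A be a linear operator on Euclidean space ℝ^m, let v₁, …, v_{k+1} ∈ ℝ^m be orthonormal vectors, and let H be a (k+1) × k real matrix such that A·v_j = Σ_{i=1}^{k+1} H_{i,j}·v_i for every j with 1 ≤ j ≤ k. Let x₀, b ∈ ℝ^m and β ∈ ℝ satisfy b − A·x₀ = β·v₁. Then for every y ∈ ℝ^k, ‖b − A·(x₀ + Σ_{j=1}^{k} y_j·v_j)‖₂ = ‖β·e₁ − H·y‖₂, where e₁ is the first standard basis vector of ℝ^{k+1}. Consequently, any y minimizing ‖H·y − β·e₁‖₂ over ℝ^k yields the vector x = x₀ + Σ_j y_j·v_j minimizing the residual ‖b − A·x‖₂ over the affine subspace x₀ + span{v₁, …, v_k}. -/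
theorem Orthonormal.norm_sum_smul {ι E : Type*} [Fintype ι] [NormedAddCommGroup E]
    [InnerProductSpace ℝ E] {v : ι → E} (hv : Orthonormal ℝ v) (w : EuclideanSpace ℝ ι) :
    ‖∑ i, w i • v i‖ = ‖w‖ := by
  rw [← sq_eq_sq₀ (norm_nonneg _) (norm_nonneg _), EuclideanSpace.real_norm_sq_eq,
    ← real_inner_self_eq_norm_sq, hv.inner_sum]
  simp [sq]

/-- Under the Arnoldi relation `A·v_j = Σ_i H_{i,j}·v_i`
(`1 ≤ j ≤ k`) with orthonormal `v₁, …, v_{k+1}` and initial residual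
`b − A·x₀ = β·v₁`, the GMRES residual identity
`‖b − A·(x₀ + Σ_j y_j·v_j)‖₂ = ‖β·e₁ − H·y‖₂` holds for every `y ∈ ℝ^k`;
consequently any minimizer `y` of `‖H·y − β·e₁‖₂` yields the minimizer of the
true residual over the affine subspace `x₀ + span{v₁, …, v_k}`. -/
theorem gmres_least_squares_residual
    (m k : ℕ) (hm : 0 < m) (hk : 0 < k)
    (A : EuclideanSpace ℝ (Fin m) →L[ℝ] EuclideanSpace ℝ (Fin m))
    (v : Fin (k + 1) → EuclideanSpace ℝ (Fin m))
    (hortho : Orthonormal ℝ v)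
    (H : Matrix (Fin (k + 1)) (Fin k) ℝ)
    (hArnoldi : ∀ j : Fin k, A (v j.castSucc) = ∑ i : Fin (k + 1), H i j • v i)
    (x₀ b : EuclideanSpace ℝ (Fin m)) (β : ℝ)
    (hres : b - A x₀ = β • v 0) :
    (∀ y : Fin k → ℝ,
      ‖b - A (x₀ + ∑ j : Fin k, y j • v j.castSucc)‖ =
        ‖β • EuclideanSpace.single (0 : Fin (k + 1)) (1 : ℝ)
            - (WithLp.equiv 2 (Fin (k + 1) → ℝ)).symm (H.mulVec y)‖) ∧
    (∀ ystar : Fin k → ℝ,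
      (∀ y : Fin k → ℝ,
        ‖(WithLp.equiv 2 (Fin (k + 1) → ℝ)).symm (H.mulVec ystar)
            - β • EuclideanSpace.single (0 : Fin (k + 1)) (1 : ℝ)‖ ≤
        ‖(WithLp.equiv 2 (Fin (k + 1) → ℝ)).symm (H.mulVec y)
            - β • EuclideanSpace.single (0 : Fin (k + 1)) (1 : ℝ)‖) →
      ∀ c : Fin k → ℝ,
        ‖b - A (x₀ + ∑ j : Fin k, ystar j • v j.castSucc)‖ ≤
          ‖b - A (x₀ + ∑ j : Fin k, c j • v j.castSucc)‖) := by
  have key (y : Fin k → ℝ) :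
      ‖b - A (x₀ + ∑ j : Fin k, y j • v j.castSucc)‖ =
        ‖β • EuclideanSpace.single (0 : Fin (k + 1)) (1 : ℝ)
            - (WithLp.equiv 2 (Fin (k + 1) → ℝ)).symm (H.mulVec y)‖ := by
    rw [← hortho.norm_sum_smul]
    congr 1
    have hA : A (∑ j : Fin k, y j • v j.castSucc) = ∑ i, (H.mulVec y) i • v i := by
      simp only [map_sum, map_smul, hArnoldi, Finset.smul_sum, smul_smul, Matrix.mulVec,
        dotProduct, Finset.sum_smul]
      rw [Finset.sum_comm]
      simp only [mul_comm]
    rw [map_add, ← sub_sub, hres, hA]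
    simp [sub_smul, Finset.sum_sub_distrib]
  refine ⟨key, fun ystar hmin c => ?_⟩
  rw [key, key, norm_sub_rev, norm_sub_rev (β • _)]
  exact hmin c
end
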